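/- For every ε > 0 there exist c > 0 and K such that for every even integer k ≥ K and every Hecke-multiplicative λ, the number of points z ∈ ℍ with Re z ∈ {0, 1/2} and f_k(z) = 0 (i.e. the number of real zeros of f_k on the segments δ₁ ∪ δ₂) is at least c · k^{1/4 − 1/80 − ε}. -/

import Mathlib

/-- `λ : ℕ → ℝ` is Hecke-multiplicative: `λ(1) = 1`, `λ` is multiplicative on coprime
arguments, satisfies the Hecke recursion at prime powers, and Deligne's bound
`|λ(p)| ≤ 2` at primes. -/
def HeckeMult (lam : ℕ → ℝ) : Prop :=
  lam 1 = 1 ∧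
  (∀ m n : ℕ, Nat.Coprime m n → lam (m * n) = lam m * lam n) ∧
  (∀ p n : ℕ, p.Prime → 1 ≤ n → lam p * lam (p ^ n) = lam (p ^ (n + 1)) + lam (p ^ (n - 1))) ∧
  (∀ p : ℕ, p.Prime → |lam p| ≤ 2)

/-- `f_k(z) = Σ_{n≥1} λ(n) n^((k-1)/2) e(nz)`. -/
noncomputable def fk (k : ℕ) (lam : ℕ → ℝ) (z : ℂ) : ℂ :=
  ∑' n : ℕ, (lam (n + 1) : ℂ) * (((n + 1 : ℕ) : ℝ) ^ (((k : ℝ) - 1) / 2) : ℝ) *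
    Complex.exp (2 * Real.pi * Complex.I * (n + 1 : ℕ) * z)

section HeckeRecursion

variable {u : ℕ → ℝ} {t : ℝ}

lemma hecke_rec_norm_form (h0 : u 0 = 1) (h1 : u 1 = t)
    (hu : ∀ n, t * u (n + 1) = u (n + 2) + u n) (n : ℕ) :
    u (n + 1) ^ 2 - t * u (n + 1) * u n + u n ^ 2 = 1 := by
  induction n with
  | zero => rw [zero_add, h0, h1]; ring
  | succ n ih =>
    have h : u (n + 2) = t * u (n + 1) - u n := by linarith [hu n]
    rw [show n + 1 + 1 = n + 2 from rfl, h]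
    linarith [ih]

lemma hecke_rec_abs_le (h0 : u 0 = 1) (h1 : u 1 = t)
    (hu : ∀ n, t * u (n + 1) = u (n + 2) + u n) (ht : |t| ≤ 2) (n : ℕ) :
    |u n| ≤ n + 1 := by
  induction n with
  | zero => simp [h0]
  | succ n ih =>
    have hn := hecke_rec_norm_form h0 h1 hu n
    have ht2 : t ^ 2 ≤ 4 := by
      have := sq_le_sq' (by linarith [abs_nonneg t]) ht
      rw [sq_abs] at this
      linarith
    have h : (u (n + 1) - t / 2 * u n) ^ 2 ≤ 1 := by
      nlinarith [mul_nonneg (sub_nonneg.2 ht2) (sq_nonneg (u n))]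
    have h2 : |u (n + 1) - t / 2 * u n| ≤ 1 := (sq_le_one_iff_abs_le_one _).1 h
    have h3 : |t / 2 * u n| ≤ |u n| := by
      rw [abs_mul]
      refine mul_le_of_le_one_left (abs_nonneg _) ?_
      rw [abs_div, abs_of_pos (by norm_num : (0 : ℝ) < 2)]
      linarith
    have h4 := abs_add_le (u (n + 1) - t / 2 * u n) (t / 2 * u n)
    rw [sub_add_cancel] at h4
    push_cast
    linarith

lemma hecke_rec_add (h0 : u 0 = 1) (h1 : u 1 = t)
    (hu : ∀ n, t * u (n + 1) = u (n + 2) + u n) (m n : ℕ) :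
    u (m + n + 2) = u (m + 1) * u (n + 1) - u m * u n := by
  induction n using Nat.twoStepInduction with
  | zero => rw [zero_add, h0, h1, add_zero]; linarith [hu m]
  | one =>
    have e2 := hu (m + 1)
    have e1 := hu m
    have e0 := hu 0
    rw [zero_add, h0, h1] at e0
    rw [h1, show m + 1 + 2 = m + 1 + 1 + 1 from rfl, show (1 + 1 : ℕ) = 0 + 2 from rfl]
    have e3 : u (0 + 2) = t * t - 1 := by linarith
    have e4 : u (m + 1 + 1) = t * u (m + 1) - u m := by linarith
    rw [e3]
    rw [show m + 1 + 2 = m + 1 + 1 + 1 from rfl, e4] at e2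
    linarith
  | more n ih1 ih2 =>
    have e1 := hu (m + n + 2)
    have e2 := hu (n + 1)
    have e3 := hu n
    simp only [← add_assoc] at *
    have e4 : u (m + n + 2 + 2) = t * u (m + n + 2 + 1) - u (m + n + 2) := by linarith
    have e5 : u (n + 2 + 1) = t * u (n + 1 + 1) - u (n + 1) := by
      linarith [show u (n + 1 + 2) = u (n + 2 + 1) from rfl]
    have e6 : u (n + 2) = t * u (n + 1) - u n := by linarith
    have ih2' : u (m + n + 2 + 1) = u (m + 1) * u (n + 2) - u m * u (n + 1) := by
      rw [show m + n + 2 + 1 = m + n + 1 + 2 from rfl]; exact ih2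
    rw [show m + n + 1 + 1 + 2 = m + n + 2 + 2 from rfl, e4, ih2', ih1,
      show n + 1 + 1 + 1 = n + 2 + 1 from rfl, e5, show n + 1 + 1 = n + 2 from rfl, e6]
    ring

lemma half_le_sq_of_hecke_rec_small (h0 : u 0 = 1) (h1 : u 1 = t)
    (hu : ∀ n, t * u (n + 1) = u (n + 2) + u n) (ht : |t| ≤ 2) {a L : ℕ} (hL : a + 2 ≤ L)
    (ha : |u (a + 1)| < 1 / (8 * L)) : 1 / 2 ≤ u a ^ 2 := by
  have hLr : (a : ℝ) + 2 ≤ L := by exact_mod_cast hL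
  have hL0 : (0 : ℝ) < L := by linarith [(Nat.cast_nonneg a : (0 : ℝ) ≤ a)]
  have hn := hecke_rec_norm_form h0 h1 hu a
  have hb := hecke_rec_abs_le h0 h1 hu ht a
  have h1' : |t * u (a + 1) * u a| ≤ 1 / 4 := by
    rw [abs_mul, abs_mul]
    calc |t| * |u (a + 1)| * |u a| ≤ 2 * (1 / (8 * L)) * L := by
          gcongr
          linarith
      _ = 1 / 4 := by field_simp; norm_num
  have h8 : 1 / (8 * (L : ℝ)) ≤ 1 / 8 := by
    apply one_div_le_one_div_of_le (by norm_num)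
    linarith [(Nat.cast_nonneg a : (0 : ℝ) ≤ a)]
  have h2' : u (a + 1) ^ 2 ≤ 1 / 4 := by
    rw [← sq_abs]
    nlinarith [abs_nonneg (u (a + 1))]
  have := (abs_le.1 h1').1
  linarith

lemma hecke_rec_three (h0 : u 0 = 1) (h1 : u 1 = t)
    (hu : ∀ n, t * u (n + 1) = u (n + 2) + u n) (ht : |t| ≤ 2) {a b L : ℕ}
    (ha : 0 < a) (hb : 0 < b) (hL : a + b + 1 ≤ L) :
    1 / (8 * L) ≤ |u a| ∨ 1 / (8 * L) ≤ |u b| ∨ 1 / (8 * (L : ℝ)) ≤ |u (a + b)| := by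
  obtain ⟨a, rfl⟩ := Nat.exists_eq_succ_of_ne_zero ha.ne'
  obtain ⟨b, rfl⟩ := Nat.exists_eq_succ_of_ne_zero hb.ne'
  by_contra! h
  obtain ⟨h3, h4, h5⟩ := h
  have ea := half_le_sq_of_hecke_rec_small h0 h1 hu ht (by omega) h3
  have eb := half_le_sq_of_hecke_rec_small h0 h1 hu ht (by omega) h4
  have e := hecke_rec_add h0 h1 hu a b
  rw [show a.succ + b.succ = a + b + 2 by omega, e] at h5
  have hLr : (1 : ℝ) ≤ L := by exact_mod_cast (by omega : 1 ≤ L)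
  have h8 : 1 / (8 * (L : ℝ)) ≤ 1 / 8 := by
    apply one_div_le_one_div_of_le (by norm_num)
    linarith
  have p1 : |u (a + 1) * u (b + 1)| ≤ 1 / 8 * (1 / 8) := by
    rw [abs_mul]
    exact mul_le_mul (h3.le.trans h8) (h4.le.trans h8) (abs_nonneg _) (by norm_num)
  have p2 : |u a * u b| < 1 / 2 := by
    have := abs_sub_abs_le_abs_sub (u a * u b) (u (a + 1) * u (b + 1))
    rw [abs_sub_comm] at this
    linarith
  have p3 : (1 / 2 : ℝ) * (1 / 2) ≤ (u a * u b) ^ 2 := by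
    rw [mul_pow]
    exact mul_le_mul ea eb (by norm_num) (sq_nonneg _)
  rw [← sq_abs] at p3
  nlinarith [abs_nonneg (u a * u b)]

end HeckeRecursion

namespace HeckeMult

variable {lam : ℕ → ℝ}

lemma prime_pow_rec (h : HeckeMult lam) {p : ℕ} (hp : p.Prime) (n : ℕ) :
    lam p * lam (p ^ (n + 1)) = lam (p ^ (n + 2)) + lam (p ^ n) :=
  h.2.2.1 p (n + 1) hp (by omega)

lemma abs_prime_pow_le (h : HeckeMult lam) {p : ℕ} (hp : p.Prime) (n : ℕ) :
    |lam (p ^ n)| ≤ n + 1 :=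
  hecke_rec_abs_le (u := fun n => lam (p ^ n)) (by simpa using h.1) (by simp)
    (h.prime_pow_rec hp) (h.2.2.2 p hp) n

lemma abs_le (h : HeckeMult lam) {n : ℕ} (hn : 0 < n) : |lam n| ≤ n := by
  induction n using Nat.recOnPosPrimePosCoprime with
  | zero => omega
  | one => simp [h.1]
  | prime_pow p n hp _ =>
    refine (h.abs_prime_pow_le hp n).trans ?_
    have h1 : n + 1 ≤ p ^ n := Nat.lt_pow_self hp.one_lt
    exact_mod_cast h1
  | coprime a b ha hb hab iha ihb =>
    rw [h.2.1 a b hab, abs_mul, Nat.cast_mul]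
    exact mul_le_mul (iha (by omega)) (ihb (by omega)) (abs_nonneg _) (Nat.cast_nonneg _)

lemma exists_half_le (h : HeckeMult lam) {p : ℕ} (hp : p.Prime) :
    ∃ e ∈ ({1, 2} : Finset ℕ), 1 / 2 ≤ |lam (p ^ e)| := by
  by_cases h1 : 1 / 2 ≤ |lam p|
  · exact ⟨1, by simp, by simpa using h1⟩
  · refine ⟨2, by simp, ?_⟩
    have h2 := h.prime_pow_rec hp 0
    simp only [zero_add, pow_one, pow_zero, h.1] at h2
    push Not at h1
    have h3 : lam p * lam p < 1 / 4 := by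
      rw [← abs_mul_abs_self]
      nlinarith [abs_nonneg (lam p)]
    rw [abs_of_neg (by linarith)]
    linarith

lemma two_pow_three (h : HeckeMult lam) {a b L : ℕ} (ha : 0 < a) (hb : 0 < b)
    (hL : a + b + 1 ≤ L) :
    1 / (8 * L) ≤ |lam (2 ^ a)| ∨ 1 / (8 * L) ≤ |lam (2 ^ b)| ∨
      1 / (8 * (L : ℝ)) ≤ |lam (2 ^ (a + b))| :=
  hecke_rec_three (u := fun n => lam (2 ^ n)) (by simpa using h.1) (by simp)
    (h.prime_pow_rec Nat.prime_two) (h.2.2.2 2 Nat.prime_two) ha hb hL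

end HeckeMult

section RealSeries

open Real

/-- The real series representing `fk` on a vertical line `Re z = α` with `e(α) = s = ±1`. -/
noncomputable def realSeries (κ s : ℝ) (lam : ℕ → ℝ) (y : ℝ) : ℝ :=
  ∑' n : ℕ, lam (n + 1) * s ^ (n + 1) * ((n + 1 : ℕ) : ℝ) ^ κ * exp (-(2 * π * (n + 1 : ℕ) * y))

lemma fk_eq_realSeries (k : ℕ) (lam : ℕ → ℝ) {α s : ℝ} (y : ℝ)
    (hs : Complex.exp (2 * π * Complex.I * α) = s) :
    fk k lam (α + y * Complex.I) = realSeries (((k : ℝ) - 1) / 2) s lam y := by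
  rw [fk, realSeries, Complex.ofReal_tsum]
  refine tsum_congr fun n => ?_
  have h : Complex.exp (2 * π * Complex.I * (n + 1 : ℕ) * (α + y * Complex.I)) =
      (s : ℂ) ^ (n + 1) * Complex.exp (-(2 * π * (n + 1 : ℕ) * y)) := by
    rw [← hs, ← Complex.exp_nat_mul, ← Complex.exp_add]
    congr 1
    linear_combination (2 * π * (n + 1 : ℕ) * y : ℂ) * Complex.I_mul_I
  rw [h]
  push_cast
  ring

lemma hasSum_succ_mul_exp_neg {q : ℝ} (hq : 0 < q) :
    HasSum (fun j : ℕ => ((j + 1 : ℕ) : ℝ) * exp (-(q * (j + 1 : ℕ))))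
      (exp (-q) / (1 - exp (-q)) ^ 2) := by
  have h1 : ‖exp (-q)‖ < 1 := by
    rw [norm_of_nonneg (exp_pos _).le]
    simpa using hq
  have h := hasSum_coe_mul_geometric_of_norm_lt_one h1
  rw [← hasSum_nat_add_iff' 1] at h
  simp only [Finset.range_one, Finset.sum_singleton, Nat.cast_zero, zero_mul, sub_zero] at h
  have e : (fun j : ℕ => ((j + 1 : ℕ) : ℝ) * exp (-(q * (j + 1 : ℕ)))) =
      fun j : ℕ => ((j + 1 : ℕ) : ℝ) * exp (-q) ^ (j + 1) := by
    funext j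
    rw [← exp_nat_mul]
    congr 2
    ring
  rw [e]
  exact h

lemma exp_neg_div_sq_le {q : ℝ} (hq : 0 < q) (hq1 : q ≤ 1) :
    exp (-q) / (1 - exp (-q)) ^ 2 ≤ 4 / q ^ 2 := by
  have h1 : exp (-q) ≤ 1 := exp_le_one_iff.2 (by linarith)
  have h2 : q / 2 ≤ 1 - exp (-q) := by
    have h3 : exp (-q) * (1 + q) ≤ 1 := by
      calc exp (-q) * (1 + q) ≤ exp (-q) * exp q := by
            gcongr
            linarith [add_one_le_exp q]
        _ = 1 := by rw [← exp_add]; simp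
    nlinarith [exp_pos (-q)]
  calc exp (-q) / (1 - exp (-q)) ^ 2 ≤ 1 / (q / 2) ^ 2 := by gcongr
    _ = 4 / q ^ 2 := by field_simp; norm_num

lemma sq_sqrt_sub_one_le {x : ℝ} (hx : 0 < x) : (√x - 1) ^ 2 ≤ x - 1 - log x := by
  have h1 : log (√x) = log x / 2 := log_sqrt hx.le
  have h2 := log_le_sub_one_of_pos (sqrt_pos.2 hx)
  nlinarith [sq_sqrt hx.le]

lemma sq_sub_one_div_le {x : ℝ} (hx : 0 < x) :
    (x - 1) ^ 2 / (2 * (x + 1)) ≤ x - 1 - log x := by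
  refine le_trans ?_ (sq_sqrt_sub_one_le hx)
  rw [div_le_iff₀ (by linarith)]
  have h := sq_sqrt hx.le
  have h3 : (x - 1) ^ 2 = (√x - 1) ^ 2 * (√x + 1) ^ 2 := by
    rw [← mul_pow]
    congr 1
    linarith
  rw [h3]
  gcongr
  nlinarith [sq_nonneg (√x - 1)]

lemma deviation_lower_bound {m n : ℕ} (hm : 0 < m) (hn : 0 < n) (hmn : m ≠ n) :
    1 / (12 * (n : ℝ) ^ 2) + m / (24 * (n : ℝ) ^ 3) ≤ (m / n : ℝ) - 1 - log (m / n) := by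
  have hm' : (0 : ℝ) < m := by exact_mod_cast hm
  have hn' : (1 : ℝ) ≤ n := by exact_mod_cast hn
  refine le_trans ?_ (sq_sub_one_div_le (by positivity))
  have e : ((m / n : ℝ) - 1) ^ 2 / (2 * (m / n + 1)) = (m - n) ^ 2 / (2 * n * (m + n)) := by
    field_simp
  rw [e]
  obtain ⟨d, hd⟩ : ∃ d : ℤ, (d : ℝ) = (m : ℝ) - n := ⟨m - n, by push_cast; ring⟩
  have hd0 : d ≠ 0 := by
    rintro rfl
    apply hmn
    have : (m : ℝ) = n := by
      simp at hd
      linarith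
    exact_mod_cast this
  have hd2 : (1 : ℝ) ≤ (d : ℝ) ^ 2 := by
    have : 0 < d ^ 2 := by positivity
    have : 1 ≤ d ^ 2 := this
    exact_mod_cast this
  have hdd : (d : ℝ) ≤ (d : ℝ) ^ 2 := by exact_mod_cast Int.le_self_sq d
  have hmd : (m : ℝ) = n + d := by linarith
  have e2 : 1 / (12 * (n : ℝ) ^ 2) + m / (24 * (n : ℝ) ^ 3) = (2 * n + m) / (24 * (n : ℝ) ^ 3) := by
    field_simp
    ring
  rw [e2, div_le_div_iff₀ (by positivity) (by positivity), ← hd]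
  have key : (2 * (n : ℝ) + m) * (m + n) ≤ 12 * n ^ 2 * d ^ 2 := by
    rw [hmd]
    have a1 : 0 ≤ (n : ℝ) ^ 2 * ((d : ℝ) ^ 2 - 1) := mul_nonneg (sq_nonneg _) (by linarith)
    have a2 : 0 ≤ (n : ℝ) * ((d : ℝ) ^ 2 - d) := mul_nonneg (by linarith) (by linarith)
    have a3 : 0 ≤ (d : ℝ) ^ 2 * ((n : ℝ) ^ 2 - n) := mul_nonneg (sq_nonneg _) (by nlinarith)
    have a4 : 0 ≤ (d : ℝ) ^ 2 * ((n : ℝ) - 1) := mul_nonneg (sq_nonneg _) (by linarith)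
    nlinarith
  nlinarith

variable {κ s : ℝ} {lam : ℕ → ℝ}

lemma norm_term_le (hlam : ∀ m, 0 < m → |lam m| ≤ m) (hs : |s| = 1) (y : ℝ) (j : ℕ) :
    ‖lam (j + 1) * s ^ (j + 1) * ((j + 1 : ℕ) : ℝ) ^ κ * exp (-(2 * π * (j + 1 : ℕ) * y))‖ ≤
      ((j + 1 : ℕ) : ℝ) * (((j + 1 : ℕ) : ℝ) ^ κ * exp (-(2 * π * (j + 1 : ℕ) * y))) := by
  rw [norm_mul, norm_mul, norm_mul, norm_pow, norm_eq_abs s, hs, one_pow, mul_one,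
    norm_of_nonneg (exp_pos _).le, norm_of_nonneg (rpow_nonneg (Nat.cast_nonneg _) _), mul_assoc]
  gcongr
  exact hlam _ j.succ_pos

lemma summable_majorant (κ : ℝ) {y : ℝ} (hy : 0 < y) :
    Summable fun j : ℕ =>
      ((j + 1 : ℕ) : ℝ) * (((j + 1 : ℕ) : ℝ) ^ κ * exp (-(2 * π * (j + 1 : ℕ) * y))) := by
  obtain ⟨N, hN⟩ := exists_nat_ge κ
  have h := (summable_nat_add_iff 1).2
    (summable_pow_mul_exp_neg_nat_mul (N + 1) (r := 2 * π * y) (by positivity))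
  refine h.of_nonneg_of_le (fun j => by positivity) fun j => ?_
  have h1 : (1 : ℝ) ≤ ((j + 1 : ℕ) : ℝ) := by exact_mod_cast j.succ_pos
  have h2 : ((j + 1 : ℕ) : ℝ) ^ κ ≤ ((j + 1 : ℕ) : ℝ) ^ N := by
    rw [← rpow_natCast]
    exact rpow_le_rpow_of_exponent_le h1 hN
  rw [← mul_assoc, pow_succ, mul_comm (((j + 1 : ℕ) : ℝ) ^ N)]
  have h3 : -(2 * π * (j + 1 : ℕ) * y) = -(2 * π * y) * ((j + 1 : ℕ) : ℝ) := by ring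
  rw [h3]
  gcongr

lemma continuousOn_realSeries (hlam : ∀ m, 0 < m → |lam m| ≤ m) (hs : |s| = 1) :
    ContinuousOn (realSeries κ s lam) (Set.Ioi 0) := by
  intro y hy
  have hy : 0 < y := hy
  refine ContinuousAt.continuousWithinAt ?_
  refine ContinuousOn.continuousAt (s := Set.Ici (y / 2)) ?_ (Ici_mem_nhds (by linarith))
  refine continuousOn_tsum (fun j => by fun_prop) (summable_majorant κ (half_pos hy)) ?_
  intro j x hx
  refine (norm_term_le hlam hs x j).trans ?_
  have hx : y / 2 ≤ x := hx
  gcongr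

lemma rpow_mul_exp_eq {n m : ℕ} (hn : 0 < n) (hm : 0 < m) :
    (m : ℝ) ^ κ * exp (-(2 * π * m * (κ / (2 * π * n)))) =
      (n : ℝ) ^ κ * exp (-κ) * exp (-(κ * ((m / n : ℝ) - 1 - log (m / n)))) := by
  have hm' : (0 : ℝ) < m := by exact_mod_cast hm
  have hn' : (0 : ℝ) < n := by exact_mod_cast hn
  rw [rpow_def_of_pos hm', rpow_def_of_pos hn', log_div hm'.ne' hn'.ne', ← exp_add, ← exp_add,
    ← exp_add]
  congr 1
  field_simp
  ring

lemma sign_realSeries (hlam : ∀ m, 0 < m → |lam m| ≤ m) (hs : |s| = 1) (hκ : 24 ≤ κ)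
    {n : ℕ} (hn : 0 < n) (hbig : exp (-(κ / (12 * (n : ℝ) ^ 2))) * (4 * (n : ℝ) ^ 6) < |lam n|) :
    0 < lam n * s ^ n * realSeries κ s lam (κ / (2 * π * n)) := by
  have hn' : (1 : ℝ) ≤ n := by exact_mod_cast hn
  set y := κ / (2 * π * n) with hy
  have hy0 : 0 < y := by positivity
  set g : ℕ → ℝ := fun j =>
    lam (j + 1) * s ^ (j + 1) * ((j + 1 : ℕ) : ℝ) ^ κ * exp (-(2 * π * (j + 1 : ℕ) * y)) with hg
  have hsum : Summable g :=
    (summable_majorant κ hy0).of_norm_bounded (norm_term_le hlam hs y)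
  set A := (n : ℝ) ^ κ * exp (-κ) with hA
  have hA0 : 0 < A := by positivity
  have hsplit : realSeries κ s lam y = g (n - 1) + ∑' j, if j = n - 1 then 0 else g j :=
    hsum.tsum_eq_add_tsum_ite (n - 1)
  have hmain : g (n - 1) = lam n * s ^ n * A := by
    have h := rpow_mul_exp_eq (κ := κ) hn hn
    rw [div_self (by positivity), log_one, ← hy] at h
    simp only [hg, Nat.sub_add_cancel hn]
    rw [mul_assoc, h]
    simp [hA]
  have hq : (0 : ℝ) < 1 / (n : ℝ) ^ 3 := by positivity
  have hq1 : 1 / (n : ℝ) ^ 3 ≤ 1 := by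
    rw [div_le_one (by positivity)]
    exact one_le_pow₀ hn'
  have hrest : |∑' j, if j = n - 1 then 0 else g j| ≤
      A * exp (-(κ / (12 * (n : ℝ) ^ 2))) * (4 * (n : ℝ) ^ 6) := by
    have hb := (hasSum_succ_mul_exp_neg hq).mul_left (A * exp (-(κ / (12 * (n : ℝ) ^ 2))))
    rw [← norm_eq_abs]
    refine (tsum_of_norm_bounded hb fun j => ?_).trans ?_
    · split_ifs with hj
      · rw [norm_zero]; positivity
      · refine (norm_term_le hlam hs y j).trans ?_
        rw [hy, rpow_mul_exp_eq hn j.succ_pos, ← hA]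
        have hd := deviation_lower_bound j.succ_pos hn (by omega)
        have h2 : κ / (12 * (n : ℝ) ^ 2) + 1 / (n : ℝ) ^ 3 * (j + 1 : ℕ) ≤
            κ * (((j + 1 : ℕ) / n : ℝ) - 1 - log ((j + 1 : ℕ) / n)) := by
          calc κ / (12 * (n : ℝ) ^ 2) + 1 / (n : ℝ) ^ 3 * (j + 1 : ℕ)
              = κ / (12 * (n : ℝ) ^ 2) + 24 * ((j + 1 : ℕ) / (24 * (n : ℝ) ^ 3)) := by
                field_simp
            _ ≤ κ / (12 * (n : ℝ) ^ 2) + κ * ((j + 1 : ℕ) / (24 * (n : ℝ) ^ 3)) := by gcongr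
            _ = κ * (1 / (12 * (n : ℝ) ^ 2) + (j + 1 : ℕ) / (24 * (n : ℝ) ^ 3)) := by ring
            _ ≤ _ := by gcongr
        have h3 : exp (-(κ * (((j + 1 : ℕ) / n : ℝ) - 1 - log ((j + 1 : ℕ) / n)))) ≤
            exp (-(κ / (12 * (n : ℝ) ^ 2))) * exp (-(1 / (n : ℝ) ^ 3 * (j + 1 : ℕ))) := by
          rw [← exp_add, exp_le_exp]
          linarith
        calc _ ≤ ((j + 1 : ℕ) : ℝ) * (A * (exp (-(κ / (12 * (n : ℝ) ^ 2))) *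
                exp (-(1 / (n : ℝ) ^ 3 * (j + 1 : ℕ))))) := by gcongr
          _ = _ := by ring
    · gcongr
      refine (exp_neg_div_sq_le hq hq1).trans (le_of_eq ?_)
      field_simp
  have hsn : |s ^ n| = 1 := by rw [abs_pow, hs, one_pow]
  have hsq : (lam n * s ^ n) * (lam n * s ^ n) = |lam n| * |lam n| := by
    rw [← abs_mul_abs_self, abs_mul, hsn, mul_one]
  have hr : |∑' j, if j = n - 1 then 0 else g j| < A * |lam n| := by
    refine hrest.trans_lt ?_
    rw [mul_assoc]
    gcongr
  have hl0 : 0 < |lam n| := lt_of_le_of_lt (by positivity) hbig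
  have hprod : |lam n * s ^ n * ∑' j, if j = n - 1 then 0 else g j| < |lam n| * (A * |lam n|) := by
    rw [abs_mul, abs_mul (lam n), hsn, mul_one]
    gcongr
  have := (abs_lt.1 hprod).1
  rw [hsplit, hmain, mul_add]
  have e : lam n * s ^ n * (lam n * s ^ n * A) = |lam n| * (A * |lam n|) := by
    rw [← mul_assoc, hsq]; ring
  rw [e]
  linarith

lemma exists_zero_realSeries (hlam : ∀ m, 0 < m → |lam m| ≤ m) (hs : |s| = 1) (hκ : 24 ≤ κ)
    {n₁ n₂ : ℕ} (hn₁ : 0 < n₁) (hn₂ : 0 < n₂)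
    (hbig₁ : exp (-(κ / (12 * (n₁ : ℝ) ^ 2))) * (4 * (n₁ : ℝ) ^ 6) < |lam n₁|)
    (hbig₂ : exp (-(κ / (12 * (n₂ : ℝ) ^ 2))) * (4 * (n₂ : ℝ) ^ 6) < |lam n₂|)
    (hsign : (lam n₁ * s ^ n₁) * (lam n₂ * s ^ n₂) < 0) {a b : ℝ}
    (h₁ : (n₁ : ℝ) ∈ Set.Ico a b) (h₂ : (n₂ : ℝ) ∈ Set.Ico a b) :
    ∃ y, 0 < y ∧ realSeries κ s lam y = 0 ∧ κ / (2 * π * y) ∈ Set.Ico a b := by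
  have hn₁' : (0 : ℝ) < n₁ := by exact_mod_cast hn₁
  have hn₂' : (0 : ℝ) < n₂ := by exact_mod_cast hn₂
  have s₁ := sign_realSeries hlam hs hκ hn₁ hbig₁
  have s₂ := sign_realSeries hlam hs hκ hn₂ hbig₂
  set y₁ := κ / (2 * π * n₁) with hy₁
  set y₂ := κ / (2 * π * n₂) with hy₂
  have p₁ : 0 < y₁ := by positivity
  have p₂ : 0 < y₂ := by positivity
  have hpos : ∀ y ∈ Set.uIcc y₁ y₂, 0 < y := fun y hy => (lt_min p₁ p₂).trans_le hy.1
  have hc : ContinuousOn (realSeries κ s lam) (Set.uIcc y₁ y₂) :=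
    (continuousOn_realSeries hlam hs).mono hpos
  have h0 : (0 : ℝ) ∈ Set.uIcc (realSeries κ s lam y₁) (realSeries κ s lam y₂) := by
    rw [Set.mem_uIcc]
    rcases mul_neg_iff.1 hsign with ⟨q₁, q₂⟩ | ⟨q₁, q₂⟩
    · right
      exact ⟨(neg_of_mul_pos_right s₂ q₂.le).le, (pos_of_mul_pos_right s₁ q₁.le).le⟩
    · left
      exact ⟨(neg_of_mul_pos_right s₁ q₁.le).le, (pos_of_mul_pos_right s₂ q₂.le).le⟩
  obtain ⟨y, hy, hzero⟩ := intermediate_value_uIcc hc h0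
  have hy0 := hpos y hy
  refine ⟨y, hy0, hzero, ?_⟩
  have e₁ : κ / (2 * π * y₁) = n₁ := by rw [hy₁]; field_simp
  have e₂ : κ / (2 * π * y₂) = n₂ := by rw [hy₂]; field_simp
  have anti : ∀ u v : ℝ, 0 < u → u ≤ v → κ / (2 * π * v) ≤ κ / (2 * π * u) := by
    intro u v hu huv
    gcongr
  rcases Set.mem_uIcc.1 hy with ⟨l, r⟩ | ⟨l, r⟩
  · exact ⟨h₂.1.trans (e₂ ▸ anti _ _ hy0 r), (anti _ _ p₁ l).trans_lt (e₁ ▸ h₁.2)⟩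
  · exact ⟨h₁.1.trans (e₁ ▸ anti _ _ hy0 r), (anti _ _ p₂ l).trans_lt (e₂ ▸ h₂.2)⟩

lemma exists_zero_fk (hlam : ∀ m, 0 < m → |lam m| ≤ m) {k : ℕ} (hk : 49 ≤ k)
    {n₁ n₂ : ℕ} (hodd : Odd n₁) (heven : Even n₂) (hn₂ : 0 < n₂)
    (hbig₁ : exp (-(((k : ℝ) - 1) / 2 / (12 * (n₁ : ℝ) ^ 2))) * (4 * (n₁ : ℝ) ^ 6) < |lam n₁|)
    (hbig₂ : exp (-(((k : ℝ) - 1) / 2 / (12 * (n₂ : ℝ) ^ 2))) * (4 * (n₂ : ℝ) ^ 6) < |lam n₂|)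
    {a b : ℝ} (h₁ : (n₁ : ℝ) ∈ Set.Ico a b) (h₂ : (n₂ : ℝ) ∈ Set.Ico a b) :
    ∃ z : ℂ, (0 < z.im ∧ (z.re = 0 ∨ z.re = 1 / 2) ∧ fk k lam z = 0) ∧
      ((k : ℝ) - 1) / 2 / (2 * π * z.im) ∈ Set.Ico a b := by
  have hκ : 24 ≤ ((k : ℝ) - 1) / 2 := by
    have : (49 : ℝ) ≤ k := by exact_mod_cast hk
    linarith
  have hne : lam n₁ * lam n₂ ≠ 0 := by
    have p₁ : 0 < |lam n₁| := lt_of_le_of_lt (by positivity) hbig₁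
    have p₂ : 0 < |lam n₂| := lt_of_le_of_lt (by positivity) hbig₂
    exact mul_ne_zero (abs_pos.1 p₁) (abs_pos.1 p₂)
  have finish : ∀ α s : ℝ, (α = 0 ∨ α = 1 / 2) → |s| = 1 →
      Complex.exp (2 * π * Complex.I * α) = s → (lam n₁ * s ^ n₁) * (lam n₂ * s ^ n₂) < 0 →
      ∃ z : ℂ, (0 < z.im ∧ (z.re = 0 ∨ z.re = 1 / 2) ∧ fk k lam z = 0) ∧
        ((k : ℝ) - 1) / 2 / (2 * π * z.im) ∈ Set.Ico a b := by
    intro α s hα hs he hsign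
    obtain ⟨y, hy, hz, hm⟩ :=
      exists_zero_realSeries hlam hs hκ hodd.pos hn₂ hbig₁ hbig₂ hsign h₁ h₂
    refine ⟨α + y * Complex.I, ⟨by simpa using hy, by simpa using hα, ?_⟩, by simpa using hm⟩
    rw [fk_eq_realSeries k lam y he, hz, Complex.ofReal_zero]
  rcases lt_or_gt_of_ne hne with h | h
  · exact finish 0 1 (Or.inl rfl) (by simp) (by simp) (by simpa using h)
  · refine finish (1 / 2) (-1) (Or.inr rfl) (by simp) ?_ ?_
    · rw [show 2 * (π : ℂ) * Complex.I * ((1 / 2 : ℝ) : ℂ) = π * Complex.I by push_cast; ring,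
        Complex.exp_pi_mul_I]
      simp
    · rw [hodd.neg_one_pow, heven.neg_one_pow]
      linarith

end RealSeries

section PrimesInBoxes

open Real Filter

lemma exists_mul_totient_le (C : ℝ) : ∃ M : ℕ, 0 < M ∧ Even M ∧ C * M.totient ≤ M := by
  have hdiv := (not_summable_iff_tendsto_nat_atTop_of_nonneg
    (f := Set.indicator {p : ℕ | p.Prime} fun n => (1 / n : ℝ))
    (fun n => Set.indicator_nonneg (fun _ _ => by positivity) n)).1 not_summable_one_div_on_primes
  obtain ⟨n, hn, hn3⟩ := ((hdiv.eventually_ge_atTop C).and (eventually_ge_atTop 3)).exists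
  have hs : ∀ p ∈ (Finset.range n).filter Nat.Prime, p.Prime := fun p hp =>
    (Finset.mem_filter.1 hp).2
  set s := (Finset.range n).filter Nat.Prime with hs_def
  have hpos : 0 < ∏ p ∈ s, p := Finset.prod_pos fun p hp => (hs p hp).pos
  refine ⟨∏ p ∈ s, p, hpos, ?_, ?_⟩
  · refine even_iff_two_dvd.2 (Finset.dvd_prod_of_mem _ ?_)
    simp only [hs_def, Finset.mem_filter, Finset.mem_range]
    exact ⟨by omega, Nat.prime_two⟩
  · have ht : ((∏ p ∈ s, p).totient : ℝ) = (∏ p ∈ s, p : ℕ) * ∏ p ∈ s, (1 - (p : ℝ)⁻¹) := by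
      have h := Nat.totient_eq_mul_prod_factors (∏ p ∈ s, p)
      rw [Nat.primeFactors_prod hs] at h
      have h' := congrArg (fun q : ℚ => (q : ℝ)) h
      push_cast at h' ⊢
      exact h'
    have hsum : C ≤ ∑ p ∈ s, (p : ℝ)⁻¹ := by
      refine hn.trans (le_of_eq ?_)
      rw [hs_def, Finset.sum_filter]
      refine Finset.sum_congr rfl fun p _ => ?_
      simp [Set.indicator_apply]
    have hprod : ∏ p ∈ s, (1 - (p : ℝ)⁻¹) ≤ exp (-C) := by
      calc ∏ p ∈ s, (1 - (p : ℝ)⁻¹) ≤ ∏ p ∈ s, exp (-(p : ℝ)⁻¹) := by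
            refine Finset.prod_le_prod (fun p hp => ?_) fun p _ => ?_
            · have : (1 : ℝ) ≤ p := by exact_mod_cast (hs p hp).one_le
              linarith [inv_le_one_of_one_le₀ this]
            · linarith [add_one_le_exp (-(p : ℝ)⁻¹)]
        _ = exp (-∑ p ∈ s, (p : ℝ)⁻¹) := by rw [← exp_sum, Finset.sum_neg_distrib]
        _ ≤ exp (-C) := exp_le_exp.2 (by linarith)
    have hC : C * exp (-C) ≤ 1 := by
      calc C * exp (-C) ≤ exp C * exp (-C) := by
            gcongr
            linarith [add_one_le_exp C]
        _ = 1 := by rw [← exp_add]; simp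
    have hP : (0 : ℝ) < (∏ p ∈ s, p : ℕ) := by exact_mod_cast hpos
    have hprod0 : 0 ≤ ∏ p ∈ s, (1 - (p : ℝ)⁻¹) :=
      Finset.prod_nonneg fun p hp => by
        have : (1 : ℝ) ≤ p := by exact_mod_cast (hs p hp).one_le
        linarith [inv_le_one_of_one_le₀ this]
    rw [ht]
    have h1 : C * ∏ p ∈ s, (1 - (p : ℝ)⁻¹) ≤ 1 := by
      rcases le_or_gt C 0 with h0 | h0
      · exact (mul_nonpos_of_nonpos_of_nonneg h0 hprod0).trans zero_le_one
      · exact (mul_le_mul_of_nonneg_left hprod h0.le).trans hC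
    calc C * ((∏ p ∈ s, p : ℕ) * ∏ p ∈ s, (1 - (p : ℝ)⁻¹))
        = (∏ p ∈ s, p : ℕ) * (C * ∏ p ∈ s, (1 - (p : ℝ)⁻¹)) := by ring
      _ ≤ (∏ p ∈ s, p : ℕ) * 1 := by gcongr
      _ = _ := mul_one _

lemma eventually_coprime_primes_ge {M : ℕ} (hM : 0 < M) :
    ∀ᶠ N : ℕ in atTop, (N : ℝ) / (2 * log N) ≤
      ((Finset.range N).filter fun p => p.Prime ∧ M.Coprime p).card := by
  have hlog : ∀ᶠ x : ℝ in atTop, ‖log x‖ ≤ 1 / (10 * (M + 2)) * ‖x‖ :=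
    isLittleO_log_id_atTop.bound (by positivity)
  have h1 := tendsto_natCast_atTop_atTop (R := ℝ) |>.eventually hlog
  have h2 := (tendsto_natCast_atTop_atTop (R := ℝ)).comp (tendsto_add_atTop_nat 1)
    |>.eventually hlog
  filter_upwards [h1, h2, eventually_ge_atTop 10] with N h1 h2 hN
  have hNr : (10 : ℝ) ≤ N := by exact_mod_cast hN
  have hl0 : 0 < log N := log_pos (by linarith)
  have hl1 : 0 ≤ log (N + 1) := log_nonneg (by linarith)
  simp only [Function.comp, Nat.cast_add, Nat.cast_one, norm_eq_abs] at h1 h2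
  rw [abs_of_pos hl0, abs_of_pos (by linarith : (0 : ℝ) < N)] at h1
  rw [abs_of_nonneg hl1, abs_of_pos (by linarith : (0 : ℝ) < N + 1)] at h2
  have hpi := Chebyshev.pi_ge N
  have hcard : Nat.primeCounting N ≤
      ((Finset.range N).filter fun p => p.Prime ∧ M.Coprime p).card + (M + 1) := by
    have hsub : (Finset.range (N + 1)).filter Nat.Prime ⊆
        ((Finset.range N).filter fun p => p.Prime ∧ M.Coprime p) ∪
          insert N (M.primeFactors) := by
      intro p hp
      simp only [Finset.mem_filter, Finset.mem_range, Finset.mem_union, Finset.mem_insert,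
        Nat.mem_primeFactors] at hp ⊢
      by_cases hc : M.Coprime p
      · rcases Nat.lt_succ_iff_lt_or_eq.1 hp.1 with h | h
        · exact Or.inl ⟨h, hp.2, hc⟩
        · exact Or.inr (Or.inl h)
      · refine Or.inr (Or.inr ⟨hp.2, ?_, hM.ne'⟩)
        rw [Nat.coprime_comm, hp.2.coprime_iff_not_dvd, not_not] at hc
        exact hc
    have h := (Finset.card_le_card hsub).trans (Finset.card_union_le _ _)
    rw [Nat.primeCounting, Nat.primeCounting', Nat.count_eq_card_filter_range]
    refine h.trans (Nat.add_le_add_left ((Finset.card_insert_le _ _).trans ?_) _)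
    gcongr
    calc M.primeFactors.card ≤ M.divisors.card :=
          Finset.card_le_card (fun p hp =>
            Nat.mem_divisors.2 ⟨Nat.dvd_of_mem_primeFactors hp, hM.ne'⟩)
      _ ≤ M := Nat.card_divisors_le_self M
  have hcard' : (Nat.primeCounting N : ℝ) ≤
      ((Finset.range N).filter fun p => p.Prime ∧ M.Coprime p).card + (M + 1) := by
    exact_mod_cast hcard
  have hl2 : 0.69 ≤ log 2 := by linarith [log_two_gt_d9]
  have e1 : (M + 2 : ℝ) * log N ≤ N / 10 := by
    calc (M + 2 : ℝ) * log N ≤ (M + 2) * (1 / (10 * (M + 2)) * N) := by gcongr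
      _ = N / 10 := by field_simp
  have e2 : log ((N : ℝ) + 1) ≤ (N + 1) / 20 := by
    refine h2.trans ?_
    rw [one_div_mul_eq_div]
    gcongr
    linarith [(Nat.cast_nonneg M : (0 : ℝ) ≤ M)]
  rw [div_le_iff₀ hl0] at hpi
  rw [div_le_iff₀ (by positivity)]
  nlinarith

/-- The `j`-th interval of length `ℓ` contains an odd prime. -/
def HasOddPrime (ℓ j : ℕ) : Prop := ∃ p : ℕ, p.Prime ∧ p ≠ 2 ∧ j * ℓ ≤ p ∧ p < (j + 1) * ℓ

open Classical in
lemma card_coprime_primes_le {M : ℕ} (hM : 0 < M) (hM2 : Even M) (B q : ℕ) (hq : 0 < q) :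
    ((Finset.range (B * (M * q))).filter fun p => p.Prime ∧ M.Coprime p).card ≤
      M.totient * (q + 1) * ((Finset.range B).filter (HasOddPrime (M * q))).card := by
  have hℓ : 0 < M * q := Nat.mul_pos hM hq
  refine Finset.card_le_mul_card_image_of_maps_to (f := fun p => p / (M * q)) ?_ _ ?_
  · intro p hp
    simp only [Finset.mem_filter, Finset.mem_range] at hp ⊢
    refine ⟨(Nat.div_lt_iff_lt_mul hℓ).2 hp.1, p, hp.2.1, ?_, Nat.div_mul_le_self _ _, ?_⟩
    · rintro rfl
      have := Nat.Coprime.eq_one_of_dvd hp.2.2.symm (even_iff_two_dvd.1 hM2)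
      omega
    · exact (Nat.div_lt_iff_lt_mul hℓ).1 (Nat.lt_succ_self _)
  · intro j _
    have h := Nat.Ico_filter_coprime_le (a := M) (j * (M * q)) (M * q) hM.ne'
    rw [Nat.mul_div_cancel_left _ hM] at h
    refine le_trans (Finset.card_le_card ?_) h
    intro p hp
    simp only [Finset.mem_filter, Finset.mem_range, Finset.mem_Ico] at hp ⊢
    obtain ⟨⟨_, _, hc⟩, rfl⟩ := hp
    refine ⟨⟨Nat.div_mul_le_self _ _, ?_⟩, hc⟩
    have := (Nat.div_lt_iff_lt_mul hℓ).1 (Nat.lt_succ_self (p / (M * q)))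
    rwa [Nat.succ_mul] at this

open Classical in
lemma le_card_of_incidences {R B : ℕ} (hR : 0 < R) (P : ℕ → ℕ → Prop)
    (hP : ∀ v < R, 6 * B ≤ R * ((Finset.range B).filter (P v)).card) :
    B ≤ R * ((Finset.range B).filter
      fun j => 5 ≤ ((Finset.range R).filter fun v => P v j).card).card := by
  have hdc : ∑ v ∈ Finset.range R, ((Finset.range B).filter (P v)).card =
      ∑ j ∈ Finset.range B, ((Finset.range R).filter fun v => P v j).card := by
    simp only [Finset.card_filter]
    exact Finset.sum_comm
  have hlow : R * (6 * B) ≤ R * ∑ v ∈ Finset.range R, ((Finset.range B).filter (P v)).card := by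
    rw [Finset.mul_sum]
    calc R * (6 * B) = ∑ v ∈ Finset.range R, 6 * B := by simp
      _ ≤ _ := Finset.sum_le_sum fun v hv => hP v (Finset.mem_range.1 hv)
  have hlow' := Nat.le_of_mul_le_mul_left hlow hR
  rw [hdc] at hlow'
  have hup : ∑ j ∈ Finset.range B, ((Finset.range R).filter fun v => P v j).card ≤
      ∑ j ∈ Finset.range B,
        ((if 5 ≤ ((Finset.range R).filter fun v => P v j).card then R else 0) + 4) := by
    refine Finset.sum_le_sum fun j _ => ?_
    have : ((Finset.range R).filter fun v => P v j).card ≤ R :=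
      (Finset.card_filter_le _ _).trans (Finset.card_range R).le
    split_ifs <;> omega
  rw [Finset.sum_add_distrib, ← Finset.sum_filter, Finset.sum_const, Finset.sum_const,
    Finset.card_range, smul_eq_mul, smul_eq_mul, mul_comm _ R] at hup
  omega

open Classical in
lemma exists_many_boxes : ∃ M : ℕ, 0 < M ∧ ∀ᶠ R : ℕ in atTop, 2 ^ (96 * R) ≤ R *
    ((Finset.range (2 ^ (96 * R))).filter fun j =>
      5 ≤ ((Finset.range R).filter fun v => HasOddPrime (M * 2 ^ (R - v)) j).card).card := by
  obtain ⟨M, hM, hM2, hMφ⟩ := exists_mul_totient_le 2352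
  refine ⟨M, hM, ?_⟩
  obtain ⟨N₀, hN₀⟩ := eventually_atTop.1 (eventually_coprime_primes_ge hM)
  filter_upwards [eventually_ge_atTop (M + N₀ + 1)] with R hR
  have hR0 : 0 < R := by omega
  refine le_card_of_incidences hR0 (fun v j => HasOddPrime (M * 2 ^ (R - v)) j) fun v hv => ?_
  set r := R - v with hr
  set B := 2 ^ (96 * R) with hB
  have hB0 : 0 < B := by positivity
  have hRp : R < 2 ^ R := Nat.lt_two_pow_self
  have hRB : R ≤ B := hRp.le.trans (Nat.pow_le_pow_right (by norm_num) (by omega))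
  have hNge : N₀ ≤ B * (M * 2 ^ r) :=
    (by omega : N₀ ≤ R).trans (hRB.trans (Nat.le_mul_of_pos_right _ (by positivity)))
  have hlow := hN₀ _ hNge
  have hup := card_coprime_primes_le hM hM2 B (2 ^ r) (by positivity)
  set h := ((Finset.range B).filter (HasOddPrime (M * 2 ^ r))).card with hh
  have hNle : B * (M * 2 ^ r) ≤ 2 ^ (98 * R) := by
    calc B * (M * 2 ^ r) ≤ 2 ^ (96 * R) * (2 ^ R * 2 ^ R) := by
          gcongr
          · omega
          · norm_num
          · omega
      _ = 2 ^ (98 * R) := by rw [← pow_add, ← pow_add]; congr 1; ring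
  have hN1 : 1 < B * (M * 2 ^ r) := by
    have h1 : 1 < B := Nat.one_lt_two_pow (by omega)
    exact h1.trans_le (Nat.le_mul_of_pos_right _ (by positivity))
  have hlogpos : 0 < log ((B * (M * 2 ^ r) : ℕ) : ℝ) := log_pos (by exact_mod_cast hN1)
  have hlogle : log ((B * (M * 2 ^ r) : ℕ) : ℝ) ≤ 98 * R := by
    have h1 : log ((B * (M * 2 ^ r) : ℕ) : ℝ) ≤ log ((2 : ℝ) ^ (98 * R)) := by
      apply log_le_log (by exact_mod_cast (by omega : 0 < B * (M * 2 ^ r)))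
      exact_mod_cast hNle
    rw [log_pow] at h1
    push_cast at h1 ⊢
    have h2 : log 2 ≤ 1 := by linarith [log_two_lt_d9]
    have h3 : (98 * (R : ℝ)) * log 2 ≤ 98 * R * 1 := by gcongr
    linarith
  have hRr : (0 : ℝ) < R := by exact_mod_cast hR0
  have hup' : (((Finset.range (B * (M * 2 ^ r))).filter fun p => p.Prime ∧ M.Coprime p).card : ℝ)
      ≤ M.totient * (2 ^ r + 1) * h := by exact_mod_cast hup
  have hmain : ((B * (M * 2 ^ r) : ℕ) : ℝ) ≤ 196 * R * (M.totient * (2 * 2 ^ r) * h) := by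
    have h1 : ((B * (M * 2 ^ r) : ℕ) : ℝ) ≤
        M.totient * (2 ^ r + 1) * h * (2 * log ((B * (M * 2 ^ r) : ℕ) : ℝ)) :=
      (div_le_iff₀ (by positivity)).1 (hlow.trans hup')
    refine h1.trans ?_
    have h2 : (1 : ℝ) ≤ 2 ^ r := one_le_pow₀ (by norm_num)
    calc (M.totient * (2 ^ r + 1) * h * (2 * log ((B * (M * 2 ^ r) : ℕ) : ℝ)) : ℝ)
        ≤ M.totient * (2 ^ r + 2 ^ r) * h * (2 * (98 * R)) := by gcongr
      _ = _ := by ring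
  have hφ : (0 : ℝ) < M.totient := by exact_mod_cast Nat.totient_pos.2 hM
  have h2r : (0 : ℝ) < 2 ^ r := by positivity
  have hfin : (6 * B : ℝ) ≤ R * h := by
    have h1 : (B : ℝ) * (2352 * M.totient * 2 ^ r) ≤ 392 * (R * h) * (M.totient * 2 ^ r) := by
      calc (B : ℝ) * (2352 * M.totient * 2 ^ r) ≤ B * (M * 2 ^ r) := by gcongr
        _ ≤ 196 * R * (M.totient * (2 * 2 ^ r) * h) := by exact_mod_cast hmain
        _ = _ := by ring
    have h2 : (392 * (M.totient * 2 ^ r) : ℝ) * (6 * B) ≤ 392 * (M.totient * 2 ^ r) * (R * h) := by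
      linarith
    exact le_of_mul_le_mul_left h2 (by positivity)
  exact_mod_cast hfin

end PrimesInBoxes

/-- The interval `[a, b)` contains an odd and a positive even integer at which `|lam|` is at
least `η`. -/
def HasOddEvenPair (lam : ℕ → ℝ) (η : ℝ) (a b : ℕ) : Prop :=
  ∃ n₁ n₂ : ℕ, Odd n₁ ∧ Even n₂ ∧ 0 < n₂ ∧ n₁ ∈ Set.Ico a b ∧ n₂ ∈ Set.Ico a b ∧
    η ≤ |lam n₁| ∧ η ≤ |lam n₂|

lemma HeckeMult.exists_odd_even_pair {lam : ℕ → ℝ} (h : HeckeMult lam) {M R j : ℕ} {e v w p q : ℕ}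
    (he : e ∈ ({1, 2} : Finset ℕ)) (hvw : v < w) (hw : w < R)
    (hp : p.Prime) (hp2 : p ≠ 2) (hq : q.Prime) (hq2 : q ≠ 2)
    (hpj : j * (M * 2 ^ (R - v)) ≤ p ∧ p < (j + 1) * (M * 2 ^ (R - v)))
    (hqj : j * (M * 2 ^ (R - w)) ≤ q ∧ q < (j + 1) * (M * 2 ^ (R - w)))
    (hlp : 1 / 2 ≤ |lam (p ^ e)|) (hlq : 1 / 2 ≤ |lam (q ^ e)|)
    (h2 : 1 / (8 * ((2 * R + 1 : ℕ) : ℝ)) ≤ |lam (2 ^ (e * (w - v)))|) :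
    HasOddEvenPair lam (1 / (32 * ((R : ℝ) + 1))) ((j * (M * 2 ^ (R - v))) ^ e)
      (((j + 1) * (M * 2 ^ (R - v))) ^ e) := by
  have he0 : e ≠ 0 := by
    rintro rfl
    simp at he
  have hR0 : (0 : ℝ) ≤ R := Nat.cast_nonneg R
  have hpow : 2 ^ (R - v) = 2 ^ (w - v) * 2 ^ (R - w) := by
    rw [← pow_add]
    congr 1
    omega
  have h2pos : 0 < 2 ^ (w - v) := by positivity
  refine ⟨p ^ e, (2 ^ (w - v) * q) ^ e, (hp.odd_of_ne_two hp2).pow, ?_, ?_, ⟨?_, ?_⟩, ⟨?_, ?_⟩,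
    ?_, ?_⟩
  · refine Even.pow_of_ne_zero ?_ he0
    exact (even_two.pow_of_ne_zero (by omega)).mul_right _
  · have := hq.pos
    positivity
  · exact Nat.pow_le_pow_left hpj.1 e
  · exact Nat.pow_lt_pow_left hpj.2 he0
  · refine Nat.pow_le_pow_left ?_ e
    rw [hpow]
    calc j * (M * (2 ^ (w - v) * 2 ^ (R - w))) = 2 ^ (w - v) * (j * (M * 2 ^ (R - w))) := by ring
      _ ≤ _ := Nat.mul_le_mul_left _ hqj.1
  · refine Nat.pow_lt_pow_left ?_ he0
    rw [hpow]
    calc 2 ^ (w - v) * q < 2 ^ (w - v) * ((j + 1) * (M * 2 ^ (R - w))) :=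
          Nat.mul_lt_mul_of_pos_left hqj.2 h2pos
      _ = _ := by ring
  · refine le_trans ?_ hlp
    apply one_div_le_one_div_of_le <;> linarith
  · have hcop : Nat.Coprime (2 ^ (e * (w - v))) (q ^ e) :=
      Nat.Coprime.pow _ _ ((Nat.coprime_primes Nat.prime_two hq).2 hq2.symm)
    rw [mul_pow, ← pow_mul, mul_comm (w - v) e, h.2.1 _ _ hcop, abs_mul]
    calc 1 / (32 * ((R : ℝ) + 1)) ≤ 1 / (8 * ((2 * R + 1 : ℕ) : ℝ)) * (1 / 2) := by
          rw [one_div_mul_one_div]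
          push_cast
          apply one_div_le_one_div_of_le <;> linarith
      _ ≤ _ := by gcongr

open Classical in
lemma HeckeMult.exists_pair_of_box {lam : ℕ → ℝ} (h : HeckeMult lam) {M R j : ℕ}
    (h5 : 5 ≤ ((Finset.range R).filter fun v => HasOddPrime (M * 2 ^ (R - v)) j).card) :
    ∃ ev ∈ ({1, 2} : Finset ℕ) ×ˢ Finset.range R, HasOddEvenPair lam (1 / (32 * ((R : ℝ) + 1)))
      ((j * (M * 2 ^ (R - ev.2))) ^ ev.1) (((j + 1) * (M * 2 ^ (R - ev.2))) ^ ev.1) := by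
  have hdata : ∀ v ∈ (Finset.range R).filter fun v => HasOddPrime (M * 2 ^ (R - v)) j,
      ∃ p e : ℕ, p.Prime ∧ p ≠ 2 ∧ (j * (M * 2 ^ (R - v)) ≤ p ∧ p < (j + 1) * (M * 2 ^ (R - v))) ∧
        e ∈ ({1, 2} : Finset ℕ) ∧ 1 / 2 ≤ |lam (p ^ e)| := by
    intro v hv
    obtain ⟨p, hp, hp2, hpj⟩ := (Finset.mem_filter.1 hv).2
    obtain ⟨e, he, hle⟩ := h.exists_half_le hp
    exact ⟨p, e, hp, hp2, hpj, he, hle⟩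
  choose! p e hp hp2 hpj he hle using hdata
  obtain ⟨e₀, he₀, hcard⟩ := Finset.exists_lt_card_fiber_of_mul_lt_card_of_maps_to
    (f := e) (t := {1, 2}) (n := 2) he (by simpa using by omega)
  obtain ⟨T, hT, hT3⟩ := Finset.exists_subset_card_eq (Nat.succ_le_of_lt hcard)
  set φ := T.orderEmbOfFin hT3 with hφ
  have hmem : ∀ i, φ i ∈ T := fun i => Finset.orderEmbOfFin_mem T hT3 i
  have h01 : φ 0 < φ 1 := φ.strictMono (by decide)
  have h12 : φ 1 < φ 2 := φ.strictMono (by decide)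
  have h2R : φ 2 < R :=
    Finset.mem_range.1 (Finset.mem_filter.1 (Finset.mem_filter.1 (hT (hmem 2))).1).1
  have he₀' : e₀ = 1 ∨ e₀ = 2 := by simpa using he₀
  have hpos : 0 < e₀ := by omega
  have hadd : e₀ * (φ 1 - φ 0) + e₀ * (φ 2 - φ 1) = e₀ * (φ 2 - φ 0) := by
    rw [← mul_add]
    congr 1
    omega
  have hL : e₀ * (φ 1 - φ 0) + e₀ * (φ 2 - φ 1) + 1 ≤ 2 * R + 1 := by
    rw [hadd]
    have := Nat.mul_le_mul (by omega : e₀ ≤ 2) (by omega : φ 2 - φ 0 ≤ R)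
    omega
  obtain ⟨v, hv, w, hw, hvw, hlam⟩ : ∃ v ∈ T, ∃ w ∈ T, v < w ∧
      1 / (8 * ((2 * R + 1 : ℕ) : ℝ)) ≤ |lam (2 ^ (e₀ * (w - v)))| := by
    rcases h.two_pow_three (Nat.mul_pos hpos (Nat.sub_pos_of_lt h01))
      (Nat.mul_pos hpos (Nat.sub_pos_of_lt h12)) hL with h' | h' | h'
    · exact ⟨_, hmem 0, _, hmem 1, h01, h'⟩
    · exact ⟨_, hmem 1, _, hmem 2, h12, h'⟩
    · rw [hadd] at h'
      exact ⟨_, hmem 0, _, hmem 2, h01.trans h12, h'⟩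
  obtain ⟨hv1, hv2⟩ := Finset.mem_filter.1 (hT hv)
  obtain ⟨hw1, hw2⟩ := Finset.mem_filter.1 (hT hw)
  have hvR := (Finset.mem_filter.1 hv1).1
  have hwR := Finset.mem_range.1 (Finset.mem_filter.1 hw1).1
  exact ⟨(e₀, v), Finset.mk_mem_product he₀ hvR, h.exists_odd_even_pair he₀ hvw hwR
    (hp v hv1) (hp2 v hv1) (hp w hw1) (hp2 w hw1) (hpj v hv1) (hpj w hw1)
    (hv2 ▸ hle v hv1) (hw2 ▸ hle w hw1) hlam⟩

lemma linear_lt_two_pow {R : ℕ} (hR : 120 ≤ R) : 1177 * R + 7 < 2 ^ R := by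
  induction R, hR using Nat.le_induction with
  | base => norm_num
  | succ R _ ih => rw [pow_succ]; omega

lemma sq_mul_two_pow_le {R : ℕ} (hR : 120 ≤ R) : R ^ 2 * 2 ^ 96 ≤ 2 ^ R := by
  induction R, hR using Nat.le_induction with
  | base => norm_num
  | succ R hR ih =>
    rw [pow_succ 2 R]
    have : (R + 1) ^ 2 ≤ 2 * R ^ 2 := by nlinarith
    calc (R + 1) ^ 2 * 2 ^ 96 ≤ 2 * R ^ 2 * 2 ^ 96 := Nat.mul_le_mul_right _ this
      _ ≤ 2 ^ R * 2 := by linarith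

lemma mul_mul_two_pow_le {R : ℕ} (hR : 120 ≤ R) :
    R * (2 * R * 2 ^ (95 * (R + 1))) ≤ 2 ^ (96 * R) := by
  rw [show 96 * R = R + 95 * R by ring, pow_add]
  refine le_trans (le_of_eq ?_) (Nat.mul_le_mul_right (2 ^ (95 * R)) (sq_mul_two_pow_le hR))
  rw [mul_add, pow_add 2 (95 * R), mul_one]
  generalize 2 ^ (95 * R) = x
  ring

open Real in
lemma tail_lt {R k n : ℕ} (hR : 120 ≤ R) (hk : 2 ^ (400 * R) ≤ k) (hn : 0 < n)
    (hnR : n ≤ 2 ^ (196 * R)) :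
    exp (-(((k : ℝ) - 1) / 2 / (12 * (n : ℝ) ^ 2))) * (4 * (n : ℝ) ^ 6) <
      1 / (32 * ((R : ℝ) + 1)) := by
  have hn0 : (0 : ℝ) < n := by exact_mod_cast hn
  have hnR' : (n : ℝ) ≤ 2 ^ (196 * R) := by exact_mod_cast hnR
  have hk' : (2 : ℝ) ^ (400 * R) ≤ k := by exact_mod_cast hk
  have h2R : (48 : ℝ) ≤ 2 ^ R := by
    calc (48 : ℝ) ≤ 2 ^ 6 := by norm_num
      _ ≤ 2 ^ R := pow_le_pow_right₀ (by norm_num) (by omega)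
  have hR2 : (R : ℝ) + 1 ≤ 2 ^ R := by exact_mod_cast (Nat.lt_two_pow_self : R < 2 ^ R)
  have hexp : (2 : ℝ) ^ R ≤ ((k : ℝ) - 1) / 2 / (12 * (n : ℝ) ^ 2) := by
    rw [div_div, le_div_iff₀ (by positivity)]
    have h2k : (2 : ℝ) ≤ k := by
      refine le_trans ?_ hk'
      calc (2 : ℝ) = 2 ^ 1 := (pow_one _).symm
        _ ≤ _ := pow_le_pow_right₀ (by norm_num) (by omega)
    have h1 : (2 : ℝ) ^ R * (2 * (12 * (n : ℝ) ^ 2)) * 2 ≤ k := by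
      calc (2 : ℝ) ^ R * (2 * (12 * (n : ℝ) ^ 2)) * 2
          = 48 * 2 ^ R * (n : ℝ) ^ 2 := by ring
        _ ≤ 2 ^ R * 2 ^ R * (2 ^ (196 * R)) ^ 2 := by gcongr
        _ = 2 ^ (394 * R) := by rw [← pow_mul, ← pow_add, ← pow_add]; congr 1; ring
        _ ≤ 2 ^ (400 * R) := pow_le_pow_right₀ (by norm_num) (by omega)
        _ ≤ k := hk'
    linarith
  have hE : (2 : ℝ) ^ (1177 * R + 7) < exp (((k : ℝ) - 1) / 2 / (12 * (n : ℝ) ^ 2)) := by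
    calc (2 : ℝ) ^ (1177 * R + 7) < 2 ^ (2 ^ R) :=
          pow_lt_pow_right₀ (by norm_num) (linear_lt_two_pow hR)
      _ ≤ exp 1 ^ (2 ^ R) := by
          gcongr
          linarith [add_one_le_exp 1]
      _ = exp (2 ^ R) := by rw [← exp_nat_mul]; push_cast; rw [mul_one]
      _ ≤ _ := exp_le_exp.2 hexp
  rw [exp_neg, inv_mul_eq_div, div_lt_div_iff₀ (exp_pos _) (by positivity), one_mul]
  refine lt_of_le_of_lt ?_ hE
  calc 4 * (n : ℝ) ^ 6 * (32 * ((R : ℝ) + 1)) ≤ 4 * (2 ^ (196 * R)) ^ 6 * (32 * 2 ^ R) := by gcongr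
    _ = 2 ^ (1177 * R + 7) := by
      rw [← pow_mul, show 1177 * R + 7 = 2 + 196 * R * 6 + (5 + R) by ring, pow_add, pow_add,
        pow_add 2 5]
      norm_num

lemma HasOddEvenPair.exists_zero {lam : ℕ → ℝ} (hlam : ∀ m, 0 < m → |lam m| ≤ m) {R k a b : ℕ}
    (hR : 120 ≤ R) (hk : 2 ^ (400 * R) ≤ k) (hb : b ≤ 2 ^ (196 * R))
    (h : HasOddEvenPair lam (1 / (32 * ((R : ℝ) + 1))) a b) :
    ∃ z : ℂ, (0 < z.im ∧ (z.re = 0 ∨ z.re = 1 / 2) ∧ fk k lam z = 0) ∧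
      ((k : ℝ) - 1) / 2 / (2 * Real.pi * z.im) ∈ Set.Ico (a : ℝ) b := by
  obtain ⟨n₁, n₂, hodd, heven, hn₂, h₁, h₂, l₁, l₂⟩ := h
  have hk49 : 49 ≤ k := by
    refine le_trans ?_ hk
    calc 49 ≤ 2 ^ 6 := by norm_num
      _ ≤ _ := Nat.pow_le_pow_right (by norm_num) (by omega)
  exact exists_zero_fk hlam hk49 hodd heven hn₂
    ((tail_lt hR hk hodd.pos (h₁.2.le.trans hb)).trans_le l₁)
    ((tail_lt hR hk hn₂ (h₂.2.le.trans hb)).trans_le l₂)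
    ⟨by exact_mod_cast h₁.1, by exact_mod_cast h₁.2⟩ ⟨by exact_mod_cast h₂.1, by exact_mod_cast h₂.2⟩

open Classical in
lemma exists_many_zeros_of_card {lam : ℕ → ℝ} (h : HeckeMult lam) {M R k B N : ℕ} (hR : 120 ≤ R)
    (hM : M ≤ R) (hk : 2 ^ (400 * R) ≤ k) (hB : B ≤ 2 ^ (96 * R)) (hN : 2 * R * N ≤
      ((Finset.range B).filter fun j =>
        5 ≤ ((Finset.range R).filter fun v => HasOddPrime (M * 2 ^ (R - v)) j).card).card) :
    ∃ S : Finset ℂ, (∀ z ∈ S, 0 < z.im ∧ (z.re = 0 ∨ z.re = 1 / 2) ∧ fk k lam z = 0) ∧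
      N ≤ S.card := by
  set J := (Finset.range B).filter fun j =>
    5 ≤ ((Finset.range R).filter fun v => HasOddPrime (M * 2 ^ (R - v)) j).card with hJ
  have hpair : ∀ j ∈ J, ∃ ev ∈ ({1, 2} : Finset ℕ) ×ˢ Finset.range R,
      HasOddEvenPair lam (1 / (32 * ((R : ℝ) + 1))) ((j * (M * 2 ^ (R - ev.2))) ^ ev.1)
        (((j + 1) * (M * 2 ^ (R - ev.2))) ^ ev.1) :=
    fun j hj => h.exists_pair_of_box (Finset.mem_filter.1 hj).2
  choose! ev hev hpair using hpair
  have hcount : (({1, 2} : Finset ℕ) ×ˢ Finset.range R).card * N ≤ J.card := by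
    rwa [Finset.card_product, Finset.card_range, Finset.card_pair (by norm_num)]
  have hne : (({1, 2} : Finset ℕ) ×ˢ Finset.range R).Nonempty :=
    ⟨(1, 0), Finset.mem_product.2 ⟨by simp, Finset.mem_range.2 (by omega)⟩⟩
  obtain ⟨⟨e, v⟩, hy, hfiber⟩ :=
    Finset.exists_le_card_fiber_of_mul_le_card_of_maps_to hev hne hcount
  obtain ⟨he, hv⟩ := Finset.mem_product.1 hy
  have he' : e = 1 ∨ e = 2 := by simpa using he
  have hzero : ∀ j ∈ J.filter fun j => ev j = (e, v),
      ∃ z : ℂ, (0 < z.im ∧ (z.re = 0 ∨ z.re = 1 / 2) ∧ fk k lam z = 0) ∧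
        ((k : ℝ) - 1) / 2 / (2 * Real.pi * z.im) ∈
          Set.Ico (((j * (M * 2 ^ (R - v))) ^ e : ℕ) : ℝ)
            (((j + 1) * (M * 2 ^ (R - v))) ^ e : ℕ) := by
    intro j hj
    obtain ⟨hjJ, hje⟩ := Finset.mem_filter.1 hj
    have hp := hpair j hjJ
    rw [hje] at hp
    refine hp.exists_zero (fun m hm => h.abs_le hm) hR hk ?_
    have hjB : j + 1 ≤ 2 ^ (96 * R) :=
      (Nat.succ_le_of_lt (Finset.mem_range.1 (Finset.mem_filter.1 hjJ).1)).trans hB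
    calc ((j + 1) * (M * 2 ^ (R - v))) ^ e ≤ (2 ^ (96 * R) * (2 ^ R * 2 ^ R)) ^ e := by
          gcongr
          · exact hM.trans Nat.lt_two_pow_self.le
          · norm_num
          · omega
      _ ≤ (2 ^ (96 * R) * (2 ^ R * 2 ^ R)) ^ 2 :=
          Nat.pow_le_pow_right (by positivity) (by omega)
      _ = 2 ^ (196 * R) := by rw [← pow_add, ← pow_add, ← pow_mul]; congr 1; ring
  choose! z hz hmem using hzero
  have hinj : Set.InjOn z (J.filter fun j => ev j = (e, v)) := by
    have key : ∀ i ∈ J.filter (fun j => ev j = (e, v)), ∀ j ∈ J.filter (fun j => ev j = (e, v)),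
        i < j → z i ≠ z j := by
      intro i hi j hj hij heq
      have h1 := (hmem i hi).2
      have h2 := (hmem j hj).1
      rw [heq] at h1
      have h3 : ((i + 1) * (M * 2 ^ (R - v))) ^ e ≤ (j * (M * 2 ^ (R - v))) ^ e :=
        Nat.pow_le_pow_left (Nat.mul_le_mul_right _ hij) e
      have h4 : ((((i + 1) * (M * 2 ^ (R - v))) ^ e : ℕ) : ℝ) ≤
          ((j * (M * 2 ^ (R - v))) ^ e : ℕ) := by exact_mod_cast h3
      linarith
    intro i hi j hj heq
    rcases lt_trichotomy i j with hij | hij | hij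
    · exact absurd heq (key i hi j hj hij)
    · exact hij
    · exact absurd heq.symm (key j hj i hi hij)
  refine ⟨(J.filter fun j => ev j = (e, v)).image z, ?_, ?_⟩
  · intro w hw
    obtain ⟨j, hj, rfl⟩ := Finset.mem_image.1 hw
    exact hz j hj
  · rw [Finset.card_image_of_injOn hinj]
    exact hfiber

open Classical in
lemma exists_many_zeros {lam : ℕ → ℝ} (h : HeckeMult lam) {M R k : ℕ} (hR : 120 ≤ R) (hM : M ≤ R)
    (hk : 2 ^ (400 * R) ≤ k) (hboxes : 2 ^ (96 * R) ≤ R *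
      ((Finset.range (2 ^ (96 * R))).filter fun j =>
        5 ≤ ((Finset.range R).filter fun v => HasOddPrime (M * 2 ^ (R - v)) j).card).card) :
    ∃ S : Finset ℂ, (∀ z ∈ S, 0 < z.im ∧ (z.re = 0 ∨ z.re = 1 / 2) ∧ fk k lam z = 0) ∧
      2 ^ (95 * (R + 1)) ≤ S.card := by
  exact exists_many_zeros_of_card h hR hM hk le_rfl
    (le_of_mul_le_mul_left ((mul_mul_two_pow_le hR).trans hboxes) (Nat.zero_lt_of_lt hR))

/-- For every `ε > 0` there are `c > 0` and `K` such that for every even `k ≥ K` and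
every Hecke-multiplicative `λ`, the number of zeros of `f_k` on the upper half-plane
with `Re z ∈ {0, 1/2}` (the real zeros on `δ₁ ∪ δ₂`) is at least
`c k^(1/4 - 1/80 - ε)`. -/
theorem stmt_15 :
    ∀ ε : ℝ, 0 < ε →
      ∃ c K : ℝ, 0 < c ∧
        ∀ k : ℕ, Even k → K ≤ (k : ℝ) →
          ∀ lam : ℕ → ℝ, HeckeMult lam →
            ∃ S : Finset ℂ,
              (∀ z ∈ S, 0 < z.im ∧ (z.re = 0 ∨ z.re = 1 / 2) ∧ fk k lam z = 0) ∧
              c * (k : ℝ) ^ (1 / 4 - 1 / 80 - ε : ℝ) ≤ (S.card : ℝ) := by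
  intro ε hε
  obtain ⟨M, -, hM⟩ := exists_many_boxes
  obtain ⟨R₀, hR₀⟩ := Filter.eventually_atTop.1 hM
  refine ⟨1, ((2 ^ (400 * (R₀ + M + 120)) : ℕ) : ℝ), one_pos, fun k _ hk lam hlam => ?_⟩
  have hk' : 2 ^ (400 * (R₀ + M + 120)) ≤ k := by exact_mod_cast hk
  have hk0 : k ≠ 0 := by
    have : 0 < 2 ^ (400 * (R₀ + M + 120)) := by positivity
    omega
  have hlog : 400 * (R₀ + M + 120) ≤ Nat.log 2 k := Nat.le_log_of_pow_le (by norm_num) hk'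
  set R := Nat.log 2 k / 400 with hR
  have hRge : R₀ + M + 120 ≤ R := by omega
  have hlow : 2 ^ (400 * R) ≤ k :=
    (Nat.pow_le_pow_right (by norm_num) (by omega)).trans (Nat.pow_log_le_self 2 hk0)
  have hupp : k ≤ 2 ^ (400 * (R + 1)) :=
    (Nat.lt_pow_succ_log_self (by norm_num) k).le.trans
      (Nat.pow_le_pow_right (by norm_num) (by omega))
  obtain ⟨S, hS, hcard⟩ :=
    exists_many_zeros hlam (by omega) (by omega) hlow (hR₀ R (by omega))
  refine ⟨S, hS, ?_⟩
  have hk1 : (1 : ℝ) ≤ k := by exact_mod_cast Nat.one_le_iff_ne_zero.2 hk0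
  calc 1 * (k : ℝ) ^ (1 / 4 - 1 / 80 - ε : ℝ) ≤ (k : ℝ) ^ (19 / 80 : ℝ) := by
        rw [one_mul]
        exact Real.rpow_le_rpow_of_exponent_le hk1 (by linarith)
    _ ≤ ((2 : ℝ) ^ (400 * (R + 1))) ^ (19 / 80 : ℝ) :=
        Real.rpow_le_rpow (by positivity) (by exact_mod_cast hupp) (by norm_num)
    _ = (2 : ℝ) ^ (95 * (R + 1)) := by
        rw [← Real.rpow_natCast, ← Real.rpow_mul (by norm_num), ← Real.rpow_natCast]
        congr 1
        push_cast
        ring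
    _ ≤ S.card := by exact_mod_cast hcard
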